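/- Let m ∈ (1,2] and β ∈ (1, 1+m]. If u ∈ {0,1}^ℕ starts with the letter 1, u ≠ 1 0̄ (i.e. u is not 1000⋯), and β > max(f_u(m), g_u(m)), then u ∈ U_β(m). -/

import Mathlib

/-- `π_β(u)` for a binary sequence `u = u₁u₂⋯` (indexed from 0). -/
noncomputable def piB (β : ℝ) (u : ℕ → Bool) : ℝ :=
  ∑' k : ℕ, (if u k then (1 : ℝ) else 0) / β ^ (k + 1)

/-- `π_β(u)` for a real digit sequence. -/
noncomputable def piR (β : ℝ) (u : ℕ → ℝ) : ℝ := ∑' k : ℕ, u k / β ^ (k + 1)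

/-- A binary sequence viewed as a real digit sequence. -/
def bR (u : ℕ → Bool) : ℕ → ℝ := fun k => if u k then 1 else 0

/-- `U_β(A)`: sequences with digits in `A` whose `π_β`-value has no other expansion over `A`. -/
def Uset (β : ℝ) (A : Set ℝ) : Set (ℕ → ℝ) :=
  {u | (∀ k, u k ∈ A) ∧ ∀ v : ℕ → ℝ, (∀ k, v k ∈ A) → v ≠ u → piR β v ≠ piR β u}

/-- `𝓛(m) = inf {β > 1 : U_β(m) ∩ {0,1}^ℕ is uncountable}`. -/
noncomputable def Lval (m : ℝ) : ℝ :=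
  sInf {β : ℝ | 1 < β ∧ ¬ (Uset β {0, 1, m} ∩ {v | ∃ u : ℕ → Bool, v = bR u}).Countable}

/-- The shift orbit `O(u)` of an infinite binary word. -/
def orbit (u : ℕ → Bool) : Set (ℕ → Bool) := {v | ∃ k : ℕ, v = fun i => u (i + k)}

/-- Suffixes of `u` preceded by the letter `1`. -/
def orbit1 (u : ℕ → Bool) : Set (ℕ → Bool) :=
  {v | ∃ k : ℕ, u k = true ∧ v = fun i => u (i + k + 1)}

/-- Suffixes of `u` preceded by the letter `0`. -/
def orbit0 (u : ℕ → Bool) : Set (ℕ → Bool) :=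
  {v | ∃ k : ℕ, u k = false ∧ v = fun i => u (i + k + 1)}

open Classical in
/-- The lexicographic supremum of a set of binary sequences (greedy construction);
`⊥ = 0̄` for the empty set. -/
noncomputable def lexSupSeq (S : Set (ℕ → Bool)) : ℕ → Bool
  | n => decide (∃ u ∈ S, (∀ i, i < n → u i = lexSupSeq S i) ∧ u n = true)
  termination_by n => n

open Classical in
/-- The lexicographic infimum of a set of binary sequences (greedy construction);
`⊤ = 1̄` for the empty set. -/
noncomputable def lexInfSeq (S : Set (ℕ → Bool)) : ℕ → Bool
  | n => decide (¬ ∃ u ∈ S, (∀ i, i < n → u i = lexInfSeq S i) ∧ u n = false)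
  termination_by n => n

/-- `sup O(u)`, the lexicographically largest limit of suffixes of `u`. -/
noncomputable def supO (u : ℕ → Bool) : ℕ → Bool := lexSupSeq (orbit u)
/-- `inf O(u)`. -/
noncomputable def infO (u : ℕ → Bool) : ℕ → Bool := lexInfSeq (orbit u)
/-- `sup₀(u)`, the supremum of the suffixes preceded by `0`. -/
noncomputable def sup0 (u : ℕ → Bool) : ℕ → Bool := lexSupSeq (orbit0 u)
/-- `inf₁(u)`, the infimum of the suffixes preceded by `1`. -/
noncomputable def inf1 (u : ℕ → Bool) : ℕ → Bool := lexInfSeq (orbit1 u)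

/-- Strict lexicographic order on infinite binary words. -/
def lexLt (u v : ℕ → Bool) : Prop := ∃ n, (∀ i, i < n → u i = v i) ∧ u n < v n
/-- Lexicographic order on infinite binary words. -/
def lexLe (u v : ℕ → Bool) : Prop := lexLt u v ∨ u = v

/-- `f_u(m)`: the unique `β ≥ 1` with `β·π_β(sup O(u)) = m`. -/
noncomputable def fVal (u : ℕ → Bool) (m : ℝ) : ℝ :=
  sInf {β : ℝ | 1 ≤ β ∧ β * piB β (supO u) = m}

/-- `g_u(m)`: the unique `β > 1` with `(β-1)(1+π_β(inf O(u))) = m`. -/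
noncomputable def gVal (u : ℕ → Bool) (m : ℝ) : ℝ :=
  sInf {β : ℝ | 1 < β ∧ (β - 1) * (1 + piB β (infO u)) = m}

/-- `μ_u`: the unique `m ∈ (1,2]` with `f_u(m) = g_u(m)`. -/
noncomputable def muVal (u : ℕ → Bool) : ℝ :=
  sInf {m : ℝ | 1 < m ∧ m ≤ 2 ∧ fVal u m = gVal u m}

/-- `u` contains at least two ones. -/
def TwoOnes (u : ℕ → Bool) : Prop := ∃ k l, k < l ∧ u k = true ∧ u l = true

/-- The substitution `L : 0 ↦ 0, 1 ↦ 01` (with `0 = false`, `1 = true`). -/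
def Lsub : Bool → List Bool := fun b => if b then [false, true] else [false]
/-- The substitution `M : 0 ↦ 01, 1 ↦ 10`. -/
def Msub : Bool → List Bool := fun b => if b then [true, false] else [false, true]
/-- The substitution `R : 0 ↦ 01, 1 ↦ 1`. -/
def Rsub : Bool → List Bool := fun b => if b then [true] else [false, true]
/-- The identity substitution. -/
def idSub : Bool → List Bool := fun b => [b]
/-- Composition of substitutions: `compSub σ τ = σ ∘ τ` (apply `τ` first). -/
def compSub (σ τ : Bool → List Bool) : Bool → List Bool := fun b => (τ b).flatMap σ

/-- The monoid `{L,M,R}*` generated by the three substitutions. -/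
def LMRstar : Set (Bool → List Bool) :=
  {σ | ∃ l : List (Bool → List Bool),
    (∀ τ ∈ l, τ = Lsub ∨ τ = Msub ∨ τ = Rsub) ∧ σ = l.foldr compSub idSub}

/-- A substitution applied to an infinite word, `σ(u₁)σ(u₂)⋯`. -/
noncomputable def substApply (σ : Bool → List Bool) (u : ℕ → Bool) : ℕ → Bool := fun n =>
  let k := sSup {k : ℕ | (∑ i ∈ Finset.range k, (σ (u i)).length) ≤ n}
  (σ (u k)).getD (n - ∑ i ∈ Finset.range k, (σ (u i)).length) false

/-- `u` is a limit word of the sequence of substitutions `σseq`. -/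
def IsLimitWord (σseq : ℕ → Bool → List Bool) (u : ℕ → Bool) : Prop :=
  ∃ useq : ℕ → ℕ → Bool, useq 0 = u ∧ ∀ n, useq n = substApply (σseq n) (useq (n + 1))

/-- Primitivity of a sequence of substitutions in `{L,M,R}^ℕ`: no tail is constantly `L`
and no tail is constantly `R`. -/
def PrimitiveSeq (σseq : ℕ → Bool → List Bool) : Prop :=
  (¬ ∃ k, ∀ n, k ≤ n → σseq n = Lsub) ∧ ¬ ∃ k, ∀ n, k ≤ n → σseq n = Rsub

/-- `S_{L,M,R}`: the set of limit words of primitive sequences of substitutions. -/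
def Sset : Set (ℕ → Bool) :=
  {u | ∃ σseq : ℕ → Bool → List Bool,
    (∀ n, σseq n = Lsub ∨ σseq n = Msub ∨ σseq n = Rsub) ∧
    PrimitiveSeq σseq ∧ IsLimitWord σseq u}

/-- The word `1 0̄ = 1000⋯`. -/
def w10bar : ℕ → Bool := fun n => decide (n = 0)
/-- The word `0 1̄ = 0111⋯`. -/
def w01bar : ℕ → Bool := fun n => decide (n ≠ 0)
/-- The word `01 0̄ = 01000⋯`. -/
def w010bar : ℕ → Bool := fun n => decide (n = 1)
/-- The word `10 1̄ = 10111⋯`. -/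
def w101bar : ℕ → Bool := fun n => decide (n ≠ 1)
/-- The word `0̄`. -/
def w0bar : ℕ → Bool := fun _ => false
/-- The word `1̄`. -/
def w1bar : ℕ → Bool := fun _ => true

/-- Prepend a letter to an infinite word. -/
def consB (b : Bool) (u : ℕ → Bool) : ℕ → Bool := fun n =>
  match n with
  | 0 => b
  | Nat.succ k => u k

/-- Prepend a finite word to an infinite word. -/
def appendW (w : List Bool) (v : ℕ → Bool) : ℕ → Bool := fun n =>
  if n < w.length then w.getD n false else v (n - w.length)

open Filter Topology

section Expansions

variable {β C : ℝ}

lemma bR_nonneg (u : ℕ → Bool) (k : ℕ) : 0 ≤ bR u k := by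
  unfold bR; split_ifs <;> norm_num

lemma bR_le_one (u : ℕ → Bool) (k : ℕ) : bR u k ≤ 1 := by
  unfold bR; split_ifs <;> norm_num

lemma piB_eq_piR (β : ℝ) (u : ℕ → Bool) : piB β u = piR β (bR u) := rfl

lemma hasSum_const_div_pow (hβ : 1 < β) (C : ℝ) :
    HasSum (fun k : ℕ => C / β ^ (k + 1)) (C / (β - 1)) := by
  have h := (hasSum_geometric_of_lt_one (r := β⁻¹) (by positivity)
    (inv_lt_one_of_one_lt₀ hβ)).mul_left (C / β)
  have hb : β - 1 ≠ 0 := by linarith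
  have hb' : β ≠ 0 := by linarith
  have hv : C / β * (1 - β⁻¹)⁻¹ = C / (β - 1) := by
    rw [show 1 - β⁻¹ = (β - 1) / β by field_simp]
    field_simp
  rw [hv] at h
  have hk : (fun k : ℕ => C / β ^ (k + 1)) = fun k => C / β * β⁻¹ ^ k := by
    funext k
    rw [inv_pow, pow_succ]
    field_simp
  rwa [hk]

lemma summable_digits (hβ : 1 < β) {v : ℕ → ℝ} (h0 : ∀ k, 0 ≤ v k) (hC : ∀ k, v k ≤ C) :
    Summable (fun k : ℕ => v k / β ^ (k + 1)) := by
  have hp : ∀ k : ℕ, 0 < β ^ (k + 1) := fun k => by positivity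
  refine Summable.of_nonneg_of_le (fun k => div_nonneg (h0 k) (hp k).le) (fun k => ?_)
    (hasSum_const_div_pow hβ C).summable
  exact div_le_div_of_nonneg_right (hC k) (hp k).le

lemma piR_nonneg (hβ : 0 ≤ β) {v : ℕ → ℝ} (h0 : ∀ k, 0 ≤ v k) : 0 ≤ piR β v :=
  tsum_nonneg fun k => div_nonneg (h0 k) (by positivity)

lemma piR_le (hβ : 1 < β) {v : ℕ → ℝ} (h0 : ∀ k, 0 ≤ v k) (hC : ∀ k, v k ≤ C) :
    piR β v ≤ C / (β - 1) := by
  rw [← (hasSum_const_div_pow hβ C).tsum_eq]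
  refine (summable_digits hβ h0 hC).tsum_le_tsum (fun k => ?_)
    (hasSum_const_div_pow hβ C).summable
  exact div_le_div_of_nonneg_right (hC k) (by positivity)

lemma piB_nonneg (hβ : 0 ≤ β) (u : ℕ → Bool) : 0 ≤ piB β u :=
  piR_nonneg hβ (bR_nonneg u)

lemma piB_le (hβ : 1 < β) (u : ℕ → Bool) : piB β u ≤ 1 / (β - 1) :=
  piR_le hβ (bR_nonneg u) (bR_le_one u)

lemma piR_eq_sum_add {v : ℕ → ℝ} (hv : Summable (fun k : ℕ => v k / β ^ (k + 1)))
    (n : ℕ) : piR β v = ∑ k ∈ Finset.range n, v k / β ^ (k + 1) +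
      piR β (fun k => v (k + n)) / β ^ n := by
  unfold piR
  rw [← hv.sum_add_tsum_nat_add n, ← tsum_div_const]
  congr 2
  funext k
  rw [div_div, ← pow_add]
  congr 2
  ring

lemma mul_piR (hβ : 0 < β) {v : ℕ → ℝ} (hv : Summable (fun k : ℕ => v k / β ^ (k + 1))) :
    β * piR β v = v 0 + piR β (fun k => v (k + 1)) := by
  rw [piR_eq_sum_add hv 1]
  simp
  field_simp

lemma piR_sub_of_agree {v w : ℕ → ℝ}
    (hv : Summable (fun k : ℕ => v k / β ^ (k + 1)))
    (hw : Summable (fun k : ℕ => w k / β ^ (k + 1))) {n : ℕ} (h : ∀ i < n, v i = w i) :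
    piR β v - piR β w =
      (piR β (fun k => v (k + n)) - piR β (fun k => w (k + n))) / β ^ n := by
  rw [piR_eq_sum_add hv n, piR_eq_sum_add hw n,
    Finset.sum_congr rfl fun k hk => by rw [h k (Finset.mem_range.mp hk)]]
  ring

lemma summable_bR (hβ : 1 < β) (u : ℕ → Bool) :
    Summable (fun k : ℕ => bR u k / β ^ (k + 1)) :=
  summable_digits hβ (bR_nonneg u) (bR_le_one u)

lemma mul_piB (hβ : 1 < β) (u : ℕ → Bool) :
    β * piB β u = bR u 0 + piB β (fun k => u (k + 1)) :=
  mul_piR (by linarith) (summable_bR hβ u)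

lemma piB_not (hβ : 1 < β) (u : ℕ → Bool) :
    piB β (fun k => !u k) = 1 / (β - 1) - piB β u := by
  rw [← (hasSum_const_div_pow hβ 1).tsum_eq, piB_eq_piR β u, piR,
    ← (hasSum_const_div_pow hβ 1).summable.tsum_sub (summable_bR hβ u)]
  refine tsum_congr fun k => ?_
  cases h : u k <;> simp [bR, h]

lemma piR_le_div_mul {b : ℝ} (hb : 1 ≤ b) (hbβ : b ≤ β) {v : ℕ → ℝ} (h0 : ∀ k, 0 ≤ v k)
    (hv : Summable (fun k : ℕ => v k / b ^ (k + 1))) : piR β v ≤ b / β * piR b v := by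
  have hle : ∀ k : ℕ, v k / β ^ (k + 1) ≤ b / β * (v k / b ^ (k + 1)) := fun k => by
    have h : b / β * (v k / b ^ (k + 1)) = v k / (β * b ^ k) := by
      rw [pow_succ]; field_simp
    rw [h, pow_succ']
    have : b ^ k ≤ β ^ k := by gcongr
    have hk : 0 < b ^ k := by positivity
    exact div_le_div_of_nonneg_left (h0 k) (by nlinarith)
      (mul_le_mul_of_nonneg_left this (by linarith))
  have hs := hv.mul_left (b / β)
  unfold piR
  rw [← tsum_mul_left]
  exact (Summable.of_nonneg_of_le (fun k => div_nonneg (h0 k) (by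
    have : 0 < β := by linarith
    positivity)) hle hs).tsum_le_tsum hle hs

lemma continuousOn_piB {b : ℝ} (hb : 1 < b) (u : ℕ → Bool) :
    ContinuousOn (fun β => piB β u) (Set.Ici b) := by
  refine continuousOn_tsum (u := fun k : ℕ => 1 / b ^ (k + 1)) (fun k => ?_)
    (hasSum_const_div_pow hb 1).summable (fun k x hx => ?_)
  · refine continuousOn_const.div (by fun_prop) fun x hx => ?_
    have : 0 < x := by linarith [Set.mem_Ici.mp hx]
    positivity
  · have hx' : b ≤ x := hx
    have hx0 : 0 < x := by linarith
    change ‖bR u k / x ^ (k + 1)‖ ≤ _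
    rw [Real.norm_of_nonneg (div_nonneg (bR_nonneg u k) (by positivity))]
    exact div_le_div₀ zero_le_one (bR_le_one u k) (by positivity) (by gcongr)

end Expansions

section Lexicographic

lemma lexSupSeq_eq_true {S : Set (ℕ → Bool)} {t : ℕ → Bool} (ht : t ∈ S) {n : ℕ}
    (h : ∀ i < n, t i = lexSupSeq S i) (hn : t n = true) : lexSupSeq S n = true := by
  classical
  rw [lexSupSeq, decide_eq_true_iff]
  exact ⟨t, ht, h, hn⟩

lemma lexInfSeq_eq_false {S : Set (ℕ → Bool)} {t : ℕ → Bool} (ht : t ∈ S) {n : ℕ}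
    (h : ∀ i < n, t i = lexInfSeq S i) (hn : t n = false) : lexInfSeq S n = false := by
  rw [lexInfSeq, decide_eq_false_iff_not]
  exact not_not_intro ⟨t, ht, h, hn⟩

lemma exists_mem_agree_lexInfSeq {S : Set (ℕ → Bool)} (hS : S.Nonempty) (n : ℕ) :
    ∃ t ∈ S, ∀ i < n, t i = lexInfSeq S i := by
  induction n with
  | zero =>
    obtain ⟨t, ht⟩ := hS
    exact ⟨t, ht, by simp⟩
  | succ n ih =>
    obtain ⟨t, ht, h⟩ := ih
    cases hn : lexInfSeq S n with
    | false =>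
      have hn' := hn
      rw [lexInfSeq, decide_eq_false_iff_not] at hn'
      obtain ⟨t', ht', h', hf⟩ := not_not.mp hn'
      refine ⟨t', ht', fun i hi => ?_⟩
      rcases Nat.lt_succ_iff_lt_or_eq.mp hi with hi | rfl
      · exact h' i hi
      · rw [hf, hn]
    | true =>
      refine ⟨t, ht, fun i hi => ?_⟩
      rcases Nat.lt_succ_iff_lt_or_eq.mp hi with hi | rfl
      · exact h i hi
      · by_contra hne
        rw [hn, Bool.not_eq_true] at hne
        rw [lexInfSeq_eq_false ht h hne] at hn
        exact absurd hn (by simp)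

lemma exists_first_ne {α : Type*} {t s : ℕ → α} (h : t ≠ s) :
    ∃ n, (∀ i < n, t i = s i) ∧ t n ≠ s n := by
  classical
  have hex : ∃ n, t n ≠ s n := Function.ne_iff.mp h
  exact ⟨Nat.find hex, fun i hi => not_not.mp (Nat.find_min hex hi), Nat.find_spec hex⟩

/-- Every suffix of `t` is lexicographically at most `s`. -/
def SuffixesLe (t s : ℕ → Bool) : Prop :=
  ∀ k n, (∀ i < n, t (i + k) = s i) → t (n + k) = true → s n = true

lemma SuffixesLe.shift {t s : ℕ → Bool} (h : SuffixesLe t s) (l : ℕ) :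
    SuffixesLe (fun i => t (i + l)) s := by
  intro k n hi hn
  simp only [add_assoc] at hi hn
  exact h (k + l) n hi hn

lemma suffixesLe_supO (u : ℕ → Bool) : SuffixesLe u (supO u) :=
  fun k _ hi hn =>
    lexSupSeq_eq_true (S := orbit u) (t := fun i => u (i + k)) ⟨k, rfl⟩ hi hn

lemma suffixesLe_infO_supO (u : ℕ → Bool) : SuffixesLe (infO u) (supO u) := by
  intro k n hi hn
  obtain ⟨t, ⟨l, rfl⟩, hl⟩ := exists_mem_agree_lexInfSeq (S := orbit u)
    ⟨u, ⟨0, rfl⟩⟩ (n + k + 1)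
  refine (suffixesLe_supO u).shift l k n (fun i hin => ?_) ?_
  · exact (hl (i + k) (by omega)).trans (hi i hin)
  · exact (hl (n + k) (by omega)).trans hn

lemma piB_le_of_suffixesLe {β : ℝ} (hβ : 1 < β) {t s : ℕ → Bool} (h : SuffixesLe t s)
    (hs : piB β s ≤ 1) : piB β t ≤ piB β s := by
  have hβ0 : 0 < β := by linarith
  have hD : 0 < 1 / (β - 1) := by
    have : 0 < β - 1 := by linarith
    positivity
  have key : ∀ (N : ℕ) (t : ℕ → Bool), SuffixesLe t s →
      piB β t ≤ piB β s + 1 / (β - 1) * β⁻¹ ^ N := by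
    intro N
    induction N with
    | zero =>
      intro t _
      have := piB_le hβ t
      have := piB_nonneg hβ0.le s
      simp only [pow_zero, mul_one]
      linarith
    | succ N ih =>
      intro t ht
      by_cases hts : t = s
      · subst hts
        have : 0 < 1 / (β - 1) * β⁻¹ ^ (N + 1) := by positivity
        linarith
      obtain ⟨n, hi, hn⟩ := exists_first_ne hts
      obtain ⟨htn, hsn⟩ : t n = false ∧ s n = true := by
        have := ht 0 n hi
        cases h1 : t n <;> cases h2 : s n <;> simp_all
      have hsub := piR_sub_of_agree (summable_bR hβ t) (summable_bR hβ s) (n := n)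
        (fun i hin => by simp only [bR, hi i hin])
      change piB β t - piB β s =
        (piB β (fun k => t (k + n)) - piB β (fun k => s (k + n))) / β ^ n at hsub
      have h1 := mul_piB hβ (fun k => t (k + n))
      have h2 := mul_piB hβ (fun k => s (k + n))
      have h3 := ih _ (ht.shift (1 + n))
      have h4 := piB_nonneg hβ0.le (fun k => s (k + 1 + n))
      simp only [bR, zero_add, htn, hsn, if_true, Bool.false_eq_true, if_false] at h1 h2
      simp only [← add_assoc] at h3
      have hx : 0 ≤ 1 / (β - 1) * β⁻¹ ^ (N + 1) := by positivity
      have h5 : piB β (fun k => t (k + n)) - piB β (fun k => s (k + n)) ≤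
          1 / (β - 1) * β⁻¹ ^ (N + 1) := by
        rw [← mul_le_mul_iff_right₀ hβ0]
        have : β * (1 / (β - 1) * β⁻¹ ^ (N + 1)) = 1 / (β - 1) * β⁻¹ ^ N := by
          rw [pow_succ]; field_simp
        rw [this, mul_sub]
        linarith
      have h6 : piB β t - piB β s ≤ 1 / (β - 1) * β⁻¹ ^ (N + 1) := by
        rw [hsub]
        calc _ ≤ (1 / (β - 1) * β⁻¹ ^ (N + 1)) / β ^ n :=
              div_le_div_of_nonneg_right h5 (by positivity)
          _ ≤ _ := div_le_self hx (one_le_pow₀ hβ.le)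
      linarith
  have hlim : Tendsto (fun N : ℕ => piB β s + 1 / (β - 1) * β⁻¹ ^ N) atTop
      (𝓝 (piB β s + 1 / (β - 1) * 0)) :=
    ((tendsto_pow_atTop_nhds_zero_of_lt_one (by positivity)
      (inv_lt_one_of_one_lt₀ hβ)).const_mul _).const_add _
  simpa using ge_of_tendsto' hlim fun N => key N t h

lemma piB_infO_le {β : ℝ} (hβ : 1 < β) {u : ℕ → Bool} (hs : piB β (supO u) ≤ 1) (k : ℕ) :
    piB β (infO u) ≤ piB β (fun i => u (i + k)) := by
  have hβ0 : 0 < β := by linarith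
  set t : ℕ → Bool := fun i => u (i + k) with ht
  by_cases hts : infO u = t
  · rw [hts]
  obtain ⟨n, hi, hn⟩ := exists_first_ne hts
  obtain ⟨hin, htn⟩ : infO u n = false ∧ t n = true := by
    have : t n = false → infO u n = false :=
      lexInfSeq_eq_false (S := orbit u) ⟨k, rfl⟩ fun i h => (hi i h).symm
    cases h1 : t n <;> cases h2 : infO u n <;> simp_all
  have hsub := piR_sub_of_agree (summable_bR hβ (infO u)) (summable_bR hβ t) (n := n)
    (fun i h => by simp only [bR, hi i h])
  change piB β (infO u) - piB β t =
    (piB β (fun k => infO u (k + n)) - piB β (fun k => t (k + n))) / β ^ n at hsub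
  have h1 := mul_piB hβ (fun k => infO u (k + n))
  have h2 := mul_piB hβ (fun k => t (k + n))
  have h3 := piB_le_of_suffixesLe hβ ((suffixesLe_infO_supO u).shift (1 + n)) hs
  have h4 := piB_nonneg hβ0.le (fun k => t (k + 1 + n))
  simp only [bR, zero_add, htn, hin, if_true, Bool.false_eq_true, if_false] at h1 h2
  simp only [← add_assoc] at h3
  have h5 : piB β (fun k => infO u (k + n)) - piB β (fun k => t (k + n)) ≤ 0 := by
    rw [← mul_le_mul_iff_right₀ hβ0, mul_sub]
    linarith
  have := div_nonpos_of_nonpos_of_nonneg h5 (pow_nonneg hβ0.le n)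
  linarith

end Lexicographic

lemma mul_piB_supO_lt {m β : ℝ} (hm : 1 < m) (hβ : 1 < β) {u : ℕ → Bool} (h : fVal u m < β) :
    β * piB β (supO u) < m := by
  by_contra! hle
  have hne : {b : ℝ | 1 ≤ b ∧ b * piB b (supO u) = m}.Nonempty := by
    set B := max β (m / (m - 1))
    have hβB : β ≤ B := le_max_left _ _
    have hB1 : 0 < B - 1 := by linarith
    have hB : B * piB B (supO u) ≤ m := by
      have h1 := piB_le (by linarith : 1 < B) (supO u)
      have h2 : m / (m - 1) ≤ B := le_max_right _ _
      rw [div_le_iff₀ (by linarith)] at h2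
      calc _ ≤ B * (1 / (B - 1)) := mul_le_mul_of_nonneg_left h1 (by linarith)
        _ = B / (B - 1) := by ring
        _ ≤ m := by rw [div_le_iff₀ hB1]; linarith
    obtain ⟨c, hc, hcm⟩ := intermediate_value_Icc' hβB (f := fun b => b * piB b (supO u))
      (continuousOn_id.mul ((continuousOn_piB hβ _).mono Set.Icc_subset_Ici_self)) ⟨hB, hle⟩
    exact ⟨c, by linarith [hc.1], hcm⟩
  obtain ⟨b, ⟨hb, hbm⟩, hbβ⟩ := exists_lt_of_csInf_lt hne h
  have hsum : Summable (fun k : ℕ => bR (supO u) k / b ^ (k + 1)) := by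
    by_contra hns
    have : piB b (supO u) = 0 := tsum_eq_zero_of_not_summable hns
    rw [this] at hbm
    linarith
  have hb0 : 0 < b := by linarith
  have hsum' : Summable (fun k : ℕ => bR (supO u) (k + 1) / b ^ (k + 1)) := by
    have := ((summable_nat_add_iff 1).mpr hsum).mul_left b
    refine this.congr fun k => ?_
    rw [pow_succ b (k + 1)]
    field_simp
  have h1 := mul_piR hb0 hsum
  have h2 := mul_piB hβ (supO u)
  have h3 := piR_le_div_mul hb hbβ.le (fun k => bR_nonneg (supO u) (k + 1)) hsum'
  have h4 := bR_le_one (supO u) 0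
  rw [← piB_eq_piR, hbm] at h1
  have h5 : 0 < piR b (fun k => bR (supO u) (k + 1)) := by linarith
  have h6 : b / β < 1 := (div_lt_one (by linarith)).mpr hbβ
  have h7 : piB β (fun k => supO u (k + 1)) = piR β (fun k => bR (supO u) (k + 1)) := rfl
  nlinarith

lemma lt_mul_one_add_piB_infO {m β : ℝ} (hm : 1 < m) (hβ : 1 < β) {u : ℕ → Bool}
    (h : gVal u m < β) : m < (β - 1) * (1 + piB β (infO u)) := by
  by_contra! hle
  have hne : {b : ℝ | 1 < b ∧ (b - 1) * (1 + piB b (infO u)) = m}.Nonempty := by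
    set B := max β (1 + m)
    have hβB : β ≤ B := le_max_left _ _
    have hB : m ≤ (B - 1) * (1 + piB B (infO u)) := by
      have h1 := piB_nonneg (by linarith : 0 ≤ B) (infO u)
      have h2 : 1 + m ≤ B := le_max_right _ _
      nlinarith
    have hc := (continuousOn_piB hβ (infO u)).mono (Set.Icc_subset_Ici_self : Set.Icc β B ⊆ _)
    obtain ⟨c, hc, hcm⟩ := intermediate_value_Icc hβB
      (f := fun b => (b - 1) * (1 + piB b (infO u)))
      ((continuousOn_id.sub continuousOn_const).mul (continuousOn_const.add hc)) ⟨hle, hB⟩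
    exact ⟨c, by linarith [hc.1], hcm⟩
  obtain ⟨b, ⟨hb, hbm⟩, hbβ⟩ := exists_lt_of_csInf_lt hne h
  have key : ∀ x : ℝ, 1 < x → (x - 1) * (1 + piB x (infO u)) =
      x - (x - 1) * piB x (fun k => !infO u k) := fun x hx => by
    have : x - 1 ≠ 0 := by linarith
    rw [piB_not hx]
    field_simp
    ring
  rw [key b hb] at hbm
  rw [key β hβ] at hle
  have hq := piR_le_div_mul hb.le hbβ.le (bR_nonneg fun k => !infO u k) (summable_bR hb _)
  simp only [← piB_eq_piR] at hq
  have hq0 := piB_nonneg (by linarith : 0 ≤ b) (fun k => !infO u k)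
  set q := piB b (fun k => !infO u k)
  have hq1 : q < 1 := by nlinarith
  have hβ0 : 0 < β := by linarith
  have h1 : (β - 1) * piB β (fun k => !infO u k) ≤ (β - 1) * (b / β * q) :=
    mul_le_mul_of_nonneg_left hq (by linarith)
  have h2 : (β - 1) * (b / β * q) = (b - 1) * q + q * (β - b) / β := by
    field_simp
    ring
  have h3 : q * (β - b) / β < β - b := by
    rw [div_lt_iff₀ hβ0]
    nlinarith
  linarith

/-- If `u` starts with `1`, `u ≠ 1 0̄`, and `β > max (f_u(m), g_u(m))`, then `u ∈ U_β(m)`. -/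
theorem gt_max_implies_mem_U (m β : ℝ) (hm : m ∈ Set.Ioc (1 : ℝ) 2)
    (hβ : β ∈ Set.Ioc (1 : ℝ) (1 + m)) (u : ℕ → Bool) (h1 : u 0 = true) (hne : u ≠ w10bar)
    (hgt : max (fVal u m) (gVal u m) < β) :
    bR u ∈ Uset β {0, 1, m} := by
  obtain ⟨hm1, -⟩ := hm
  have hβ1 : 1 < β := hβ.1
  have hβ0 : 0 < β := by linarith
  have hf := mul_piB_supO_lt hm1 hβ1 (lt_of_le_of_lt (le_max_left _ _) hgt)
  have hg := lt_mul_one_add_piB_infO hm1 hβ1 (lt_of_le_of_lt (le_max_right _ _) hgt)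
  have hmβ : m < β := by
    have h := mul_le_mul_of_nonneg_left (piB_le hβ1 (infO u)) (by linarith : 0 ≤ β - 1)
    rw [mul_one_div_cancel (by linarith)] at h
    linarith
  have hs : piB β (supO u) < 1 := by
    by_contra! h
    nlinarith
  have hsup : ∀ k, piB β (fun i => u (i + k)) ≤ piB β (supO u) := fun k =>
    piB_le_of_suffixesLe hβ1 ((suffixesLe_supO u).shift k) hs.le
  refine ⟨fun k => by cases h : u k <;> simp [bR, h], fun v hv hvu heq => ?_⟩
  have hv0 : ∀ k, 0 ≤ v k := fun k => by
    rcases hv k with h | h | h <;> rw [h] <;> linarith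
  have hvm : ∀ k, v k ≤ m := fun k => by
    rcases hv k with h | h | h <;> rw [h] <;> linarith
  obtain ⟨n, hi, hn⟩ := exists_first_ne hvu
  have hsub := piR_sub_of_agree (summable_digits hβ1 hv0 hvm) (summable_bR hβ1 u) hi
  rw [heq, sub_self, eq_comm, div_eq_zero_iff, or_iff_left (pow_ne_zero n hβ0.ne')] at hsub
  have hz := mul_piR hβ0 (summable_digits hβ1 (fun k => hv0 (k + n)) fun k => hvm (k + n))
  have hw := mul_piB hβ1 (fun k => u (k + n))
  have hwz : piR β (fun k => v (k + n)) = piB β (fun k => u (k + n)) := sub_eq_zero.mp hsub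
  rw [hwz] at hz
  have hz0 := piR_nonneg hβ0.le (fun k => hv0 (k + 1 + n))
  have hzm := piR_le hβ1 (fun k => hv0 (k + 1 + n)) (fun k => hvm (k + 1 + n))
  have hs1 := hsup (1 + n)
  have hi1 := piB_infO_le hβ1 hs.le (1 + n)
  simp only [← add_assoc] at hs1 hi1
  simp only [zero_add] at hz hw
  cases hun : u n with
  | false =>
    simp only [bR, zero_add, hun, Bool.false_eq_true, if_false] at hw hn
    rcases hv n with h | h | h
    · exact hn h
    all_goals rw [h] at hz; linarith
  | true =>
    simp only [bR, zero_add, hun, if_true] at hw hn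
    rcases hv n with h | h | h
    · rw [h] at hz
      rw [le_div_iff₀ (by linarith)] at hzm
      nlinarith
    · exact hn h
    · rw [h] at hz
      have := mul_le_mul_of_nonneg_left (hsup n) hβ0.le
      linarith
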